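/- Fix n ≥ 2 and let H_m(z) be defined by H_m(z) = (−1)^m B(z)^m for 0 ≤ m < n and H_m(z) = −B(z)H_{m−1}(z) − A(z)H_{m−n}(z) for m ≥ n. If m = np + r with 0 ≤ r < n, then B(z)^r divides H_m(z) in ℂ[z]. -/

import Mathlib

theorem stmt_8 (n : ℕ) (hn : 2 ≤ n) (A B : Polynomial ℂ) (H : ℕ → Polynomial ℂ)
    (hinit : ∀ m < n, H m = (-1) ^ m * B ^ m)
    (hrec : ∀ m, n ≤ m → H m = -(B * H (m - 1)) - A * H (m - n))
    (m p r : ℕ) (hm : m = n * p + r) (hr : r < n) :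
    B ^ r ∣ H m := by
  subst hm
  induction p generalizing r with
  | zero =>
    rw [Nat.mul_zero, Nat.zero_add, hinit r hr]
    exact Dvd.intro_left _ rfl
  | succ p ihp =>
    induction r with
    | zero => simp
    | succ r ihr =>
      have e : n * (p + 1) = n * p + n := by ring
      rw [hrec (n * (p + 1) + (r + 1)) (by rw [e]; omega)]
      have h1 : n * (p + 1) + (r + 1) - 1 = n * (p + 1) + r := by omega
      have h2 : n * (p + 1) + (r + 1) - n = n * p + (r + 1) := by rw [e]; omega
      rw [h1, h2]
      refine dvd_sub ?_ ?_
      · rw [dvd_neg, pow_succ']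
        exact mul_dvd_mul_left B (ihr (by omega))
      · exact Dvd.dvd.mul_left (ihp (r + 1) hr) A
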